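/- For every p > 2 and every ℓ > 0 there exists a unique z ∈ (0, (p/2)^(1/(p−2))) such that L(z) = ℓ. -/

import Mathlib

open MeasureTheory

/-- `f(t) = t²/2 - tᵖ/p`. -/
noncomputable def f (p t : ℝ) : ℝ := t ^ 2 / 2 - t ^ p / p

/-- `g(t) = tᵖ⁻¹ - t = -f'(t)`. -/
noncomputable def g (p t : ℝ) : ℝ := t ^ (p - 1) - t

section Basic

variable {p : ℝ}

lemma hasStrictDerivAt_f (hp : 2 < p) (t : ℝ) : HasStrictDerivAt (f p) (-g p t) t := by
  have h1 : HasStrictDerivAt (fun t : ℝ => t ^ p) (p * t ^ (p - 1)) t :=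
    Real.hasStrictDerivAt_rpow_const (Or.inr (by linarith))
  have h2 := (((hasStrictDerivAt_id t).pow 2).div_const 2).sub (h1.div_const p)
  have hp0 : p ≠ 0 := by linarith
  refine h2.congr_deriv ?_
  simp only [g, id]
  field_simp
  ring

lemma hasDerivAt_f (hp : 2 < p) (t : ℝ) : HasDerivAt (f p) (-g p t) t :=
  (hasStrictDerivAt_f hp t).hasDerivAt

lemma continuous_f (hp : 2 < p) : Continuous (f p) :=
  continuous_iff_continuousAt.2 fun t => (hasDerivAt_f hp t).continuousAt

lemma hasDerivAt_g (hp : 2 < p) (t : ℝ) :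
    HasDerivAt (g p) ((p - 1) * t ^ (p - 2) - 1) t := by
  have h1 : HasDerivAt (fun t : ℝ => t ^ (p - 1)) ((p - 1) * t ^ (p - 1 - 1)) t :=
    Real.hasDerivAt_rpow_const (Or.inr (by linarith))
  refine (h1.sub (hasDerivAt_id t)).congr_deriv ?_
  rw [show p - 1 - 1 = p - 2 by ring]

lemma continuous_g (hp : 2 < p) : Continuous (g p) :=
  continuous_iff_continuousAt.2 fun t => (hasDerivAt_g hp t).continuousAt

lemma g_eq_mul {t : ℝ} (ht : 0 < t) : g p t = t * (t ^ (p - 2) - 1) := by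
  have : t ^ (p - 1) = t * t ^ (p - 2) := by
    rw [show p - 1 = 1 + (p - 2) by ring, Real.rpow_add ht, Real.rpow_one]
  rw [g, this]
  ring

lemma f_eq_mul {t : ℝ} (ht : 0 < t) : f p t = t ^ 2 * (1 / 2 - t ^ (p - 2) / p) := by
  have : t ^ p = t ^ 2 * t ^ (p - 2) := by
    conv_lhs => rw [show p = 2 + (p - 2) by ring, Real.rpow_add ht, Real.rpow_two]
  rw [f, this]
  ring

lemma one_lt_rpow_sub_two (hp : 2 < p) {t : ℝ} (ht : 1 < t) : 1 < t ^ (p - 2) :=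
  Real.one_lt_rpow ht (by linarith)

lemma g_one : g p 1 = 0 := by simp [g]

lemma g_pos (hp : 2 < p) {t : ℝ} (ht : 1 < t) : 0 < g p t := by
  rw [g_eq_mul (by linarith)]
  exact mul_pos (by linarith) (by linarith [one_lt_rpow_sub_two hp ht])

lemma g_neg (hp : 2 < p) {t : ℝ} (h0 : 0 < t) (ht : t < 1) : g p t < 0 := by
  rw [g_eq_mul h0]
  exact mul_neg_of_pos_of_neg h0 (by linarith [Real.rpow_lt_one h0.le ht (by linarith : 0 < p - 2)])

lemma deriv_g_pos (hp : 2 < p) {t : ℝ} (ht : 1 < t) : 0 < (p - 1) * t ^ (p - 2) - 1 := by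
  nlinarith [one_lt_rpow_sub_two hp ht]

lemma strictConvexOn_g (hp : 2 < p) : StrictConvexOn ℝ (Set.Ici 0) (g p) :=
  (strictConvexOn_rpow (by linarith : 1 < p - 1)).sub_concaveOn (concaveOn_id (convex_Ici 0))

lemma strictMonoOn_g (hp : 2 < p) : StrictMonoOn (g p) (Set.Ici 1) := by
  refine strictMonoOn_of_deriv_pos (convex_Ici 1) (continuous_g hp).continuousOn fun t ht => ?_
  rw [interior_Ici] at ht
  rw [(hasDerivAt_g hp t).deriv]
  exact deriv_g_pos hp ht

lemma strictAntiOn_f (hp : 2 < p) : StrictAntiOn (f p) (Set.Ici 1) := by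
  refine strictAntiOn_of_deriv_neg (convex_Ici 1) (continuous_f hp).continuousOn fun t ht => ?_
  rw [interior_Ici] at ht
  rw [(hasDerivAt_f hp t).deriv]
  linarith [g_pos hp ht]

lemma strictMonoOn_f (hp : 2 < p) : StrictMonoOn (f p) (Set.Icc 0 1) := by
  refine strictMonoOn_of_deriv_pos (convex_Icc 0 1) (continuous_f hp).continuousOn fun t ht => ?_
  rw [interior_Icc] at ht
  rw [(hasDerivAt_f hp t).deriv]
  linarith [g_neg hp ht.1 ht.2]

lemma concaveOn_f (hp : 2 < p) : ConcaveOn ℝ (Set.Ici 1) (f p) := by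
  refine AntitoneOn.concaveOn_of_deriv (convex_Ici 1) (continuous_f hp).continuousOn
    (fun t _ => (hasDerivAt_f hp t).differentiableAt.differentiableWithinAt) ?_
  intro s hs t ht hst
  rw [interior_Ici] at hs ht
  rw [(hasDerivAt_f hp t).deriv, (hasDerivAt_f hp s).deriv]
  exact neg_le_neg ((strictMonoOn_g hp).monotoneOn (Set.mem_Ici.2 (le_of_lt hs))
    (Set.mem_Ici.2 (le_of_lt ht)) hst)

lemma one_lt_zero_f (hp : 2 < p) : 1 < (p / 2) ^ (1 / (p - 2)) :=
  Real.one_lt_rpow (by linarith) (one_div_pos.2 (by linarith))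

lemma f_zero_eq (hp : 2 < p) : f p ((p / 2) ^ (1 / (p - 2))) = 0 := by
  rw [f_eq_mul (by linarith [one_lt_zero_f hp]), ← Real.rpow_mul (by linarith),
    one_div_mul_cancel (by linarith), Real.rpow_one]
  have : p ≠ 0 := by linarith
  field_simp
  ring

lemma f_pos (hp : 2 < p) {z : ℝ} (hz : z ∈ Set.Ioo (0 : ℝ) ((p / 2) ^ (1 / (p - 2)))) :
    0 < f p z := by
  have h : z ^ (p - 2) < p / 2 := by
    have := Real.rpow_lt_rpow hz.1.le hz.2 (by linarith : 0 < p - 2)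
    rwa [← Real.rpow_mul (by linarith), one_div_mul_cancel (by linarith), Real.rpow_one] at this
  rw [f_eq_mul hz.1]
  refine mul_pos (pow_pos hz.1 2) ?_
  have : z ^ (p - 2) / p < 1 / 2 := by
    rw [div_lt_iff₀ (by linarith)]
    linarith
  linarith

/-- `log g` is concave on `(1, ∞)`: its tangent line at `b` lies above the graph. -/
lemma sub_mul_deriv_g_le (hp : 2 < p) {a b : ℝ} (ha : 1 < a) (hab : a < b) :
    (b - a) * ((p - 1) * b ^ (p - 2) - 1) ≤ g p b * (Real.log (g p b) - Real.log (g p a)) := by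
  obtain ⟨c, ⟨hac, hcb⟩, hc⟩ := exists_hasDerivAt_eq_slope (fun t => Real.log (g p t))
    (fun t => ((p - 1) * t ^ (p - 2) - 1) / g p t) hab
    (fun t ht => ((hasDerivAt_g hp t).log
      (g_pos hp (ha.trans_le ht.1)).ne').continuousAt.continuousWithinAt)
    (fun t ht => (hasDerivAt_g hp t).log (g_pos hp (ha.trans ht.1)).ne')
  have h1c : 1 < c := ha.trans hac
  have h1b : 1 < b := h1c.trans hcb
  have key : ((p - 1) * b ^ (p - 2) - 1) / g p b ≤ ((p - 1) * c ^ (p - 2) - 1) / g p c := by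
    have e : ∀ t : ℝ, 1 < t → ((p - 1) * t ^ (p - 2) - 1) / g p t =
        1 / t * ((p - 1) + (p - 2) / (t ^ (p - 2) - 1)) := by
      intro t ht
      have := one_lt_rpow_sub_two hp ht
      have h0 : t ^ (p - 2) - 1 ≠ 0 := by linarith
      have h1 : t ≠ 0 := by linarith
      rw [g_eq_mul (by linarith)]
      field_simp
      ring
    have hs : c ^ (p - 2) ≤ b ^ (p - 2) :=
      Real.rpow_le_rpow (by linarith) hcb.le (by linarith)
    have hs1 := one_lt_rpow_sub_two hp h1c
    rw [e b h1b, e c h1c]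
    have hpos : 0 ≤ (p - 1) + (p - 2) / (b ^ (p - 2) - 1) :=
      add_nonneg (by linarith) (div_nonneg (by linarith) (by linarith))
    have h2 : (p - 2) / (b ^ (p - 2) - 1) ≤ (p - 2) / (c ^ (p - 2) - 1) :=
      div_le_div_of_nonneg_left (by linarith) (by linarith) (by linarith)
    have h3 : 1 / b ≤ 1 / c := one_div_le_one_div_of_le (by linarith) hcb.le
    have h4 : 0 ≤ 1 / c := by positivity
    exact mul_le_mul h3 (by linarith) hpos h4
  rw [hc, div_le_div_iff₀ (g_pos hp h1b) (by linarith)] at key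
  linarith

lemma three_mul_mul_log_inv_lt {r : ℝ} (h0 : 0 < r) (h1 : r < 1) :
    3 * r * Real.log r⁻¹ < 1 + 3 * r := by
  have hs : 0 < √r := Real.sqrt_pos.2 h0
  have hs1 : √r < 1 := (Real.sqrt_lt' one_pos).2 (by simpa using h1)
  have hsq : √r * √r = r := Real.mul_self_sqrt h0.le
  have hl : Real.log (√r)⁻¹ < (√r)⁻¹ - 1 :=
    Real.log_lt_sub_one_of_pos (inv_pos.2 hs) (by
      intro h
      rw [inv_eq_one] at h
      linarith)
  have e : Real.log r⁻¹ = 2 * Real.log (√r)⁻¹ := by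
    rw [Real.log_inv, Real.log_inv, Real.log_sqrt h0.le]
    ring
  have hm : r * (√r)⁻¹ = √r := by
    nth_rewrite 1 [← hsq]
    rw [mul_assoc, mul_inv_cancel₀ hs.ne', mul_one]
  have := mul_lt_mul_of_pos_left hl (by linarith : 0 < 6 * r)
  rw [e]
  nlinarith [sq_nonneg (3 * √r - 1)]

end Basic

section Integral

variable {p : ℝ}

lemma chord_le_f (hp : 2 < p) {a b t : ℝ} (ha : 0 < a) (hb : 1 < b) (hab : a < b)
    (hf : f p b < f p a) (ht : t ∈ Set.Icc a b) :
    (f p a - f p b) / (b - a) * (b - t) ≤ f p t - f p b := by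
  obtain ⟨hat, htb⟩ := ht
  have hba : 0 < b - a := by linarith
  rcases le_total t 1 with h1 | h1
  · have hm : f p a ≤ f p t := (strictMonoOn_f hp).monotoneOn ⟨ha.le, hat.trans h1⟩
      ⟨(ha.trans_le hat).le, h1⟩ hat
    have : (f p a - f p b) / (b - a) * (b - t) ≤ f p a - f p b := by
      rw [div_mul_eq_mul_div, div_le_iff₀ hba]
      exact mul_le_mul_of_nonneg_left (by linarith) (by linarith)
    linarith
  · obtain ⟨c, hc1, hac, hct, hfc⟩ : ∃ c, 1 ≤ c ∧ a ≤ c ∧ c ≤ t ∧ f p a ≤ f p c := by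
      rcases le_total a 1 with h | h
      · exact ⟨1, le_rfl, h, h1, (strictMonoOn_f hp).monotoneOn ⟨ha.le, h⟩ ⟨zero_le_one, le_rfl⟩ h⟩
      · exact ⟨a, h, le_rfl, hat, le_rfl⟩
    rcases eq_or_lt_of_le htb with rfl | htb
    · simp
    have hbc : 0 < b - c := by linarith
    have hcc := (concaveOn_f hp).2 (Set.mem_Ici.2 hc1) (Set.mem_Ici.2 hb.le)
      (div_nonneg (by linarith : 0 ≤ b - t) hbc.le) (div_nonneg (by linarith : 0 ≤ t - c) hbc.le)
      (by field_simp; ring)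
    have e : ((b - t) / (b - c)) • c + ((t - c) / (b - c)) • b = t := by
      simp only [smul_eq_mul]
      field_simp
      ring
    have e2 : ((b - t) / (b - c)) • f p c + ((t - c) / (b - c)) • f p b =
        (f p c - f p b) / (b - c) * (b - t) + f p b := by
      simp only [smul_eq_mul]
      field_simp
      ring
    rw [e, e2] at hcc
    have : (f p a - f p b) / (b - a) ≤ (f p c - f p b) / (b - c) :=
      div_le_div₀ (by linarith) (by linarith) hbc (by linarith)
    have := mul_le_mul_of_nonneg_right this (by linarith : 0 ≤ b - t)
    linarith

lemma one_div_sqrt_le {c u x : ℝ} (hc : 0 < c) (hu : 0 ≤ u) (h : c * u ≤ x) (h0 : u = 0 → x = 0) :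
    1 / √x ≤ 1 / √c * u ^ (-(1 / 2) : ℝ) := by
  rcases hu.eq_or_lt with rfl | hu
  · simp only [h0 rfl, Real.sqrt_zero, div_zero]
    positivity
  · rw [Real.rpow_neg hu.le, ← Real.sqrt_eq_rpow, ← one_div, one_div_mul_one_div,
      ← Real.sqrt_mul hc.le]
    exact one_div_le_one_div_of_le (Real.sqrt_pos.2 (mul_pos hc hu)) (Real.sqrt_le_sqrt h)

lemma intervalIntegrable_sub_rpow (a b c : ℝ) :
    IntervalIntegrable (fun t => (c - t) ^ (-(1 / 2) : ℝ)) volume a b := by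
  have := (intervalIntegral.intervalIntegrable_rpow' (a := c - a) (b := c - b)
    (by norm_num : (-1 : ℝ) < -(1 / 2))).comp_sub_left c
  simpa using this

lemma intervalIntegrable_one_div_sqrt (hp : 2 < p) {a b : ℝ} (ha : 0 < a) (hb : 1 < b)
    (hab : a < b) (hf : f p b < f p a) :
    IntervalIntegrable (fun t => 1 / √(f p t - f p b)) volume a b := by
  refine ((intervalIntegrable_sub_rpow a b b).const_mul
    (1 / √((f p a - f p b) / (b - a)))).mono_fun' ?_ ?_
  · have := (continuous_f hp).measurable
    exact Measurable.aestronglyMeasurable (by fun_prop)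
  · refine (ae_restrict_iff' measurableSet_uIoc).2 (Filter.Eventually.of_forall fun t ht => ?_)
    rw [Set.uIoc_of_le hab.le] at ht
    beta_reduce
    rw [Real.norm_of_nonneg (by positivity)]
    refine one_div_sqrt_le (div_pos (by linarith) (by linarith)) (by linarith [ht.2])
      (chord_le_f hp ha hb hab hf (Set.Ioc_subset_Icc_self ht)) fun h => ?_
    rw [show t = b by linarith, sub_self]

/-- The integrand of the length function after the affine change of variables
`t = a + (b - a) θ`. -/
noncomputable def scaledIntegrand (p a b θ : ℝ) : ℝ :=
  (b - a) * (1 / √(f p (a + (b - a) * θ) - f p b))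

lemma integral_eq_scaled (p a b : ℝ) :
    ∫ t in a..b, 1 / √(f p t - f p b) = ∫ θ in (0 : ℝ)..1, scaledIntegrand p a b θ := by
  have := intervalIntegral.mul_integral_comp_add_mul (a := 0) (b := 1)
    (f := fun t => 1 / √(f p t - f p b)) (b - a) a
  simp only [scaledIntegrand]
  rw [intervalIntegral.integral_const_mul, this]
  simp

lemma measurable_scaledIntegrand (hp : 2 < p) (a b : ℝ) : Measurable (scaledIntegrand p a b) := by
  have := (continuous_f hp).measurable
  unfold scaledIntegrand
  fun_prop

lemma scaledIntegrand_nonneg {a b : ℝ} (hab : a ≤ b) (θ : ℝ) : 0 ≤ scaledIntegrand p a b θ :=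
  mul_nonneg (by linarith) (by positivity)

lemma add_mul_mem_Icc {a b θ : ℝ} (hab : a ≤ b) (hθ : θ ∈ Set.Icc (0 : ℝ) 1) :
    a + (b - a) * θ ∈ Set.Icc a b :=
  ⟨by nlinarith [hθ.1], by nlinarith [hθ.2]⟩

lemma mul_one_sub_le_f (hp : 2 < p) {a b θ : ℝ} (ha : 0 < a) (hb : 1 < b) (hab : a < b)
    (hf : f p b < f p a) (hθ : θ ∈ Set.Icc (0 : ℝ) 1) :
    (f p a - f p b) * (1 - θ) ≤ f p (a + (b - a) * θ) - f p b := by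
  refine le_trans (le_of_eq ?_) (chord_le_f hp ha hb hab hf (add_mul_mem_Icc hab.le hθ))
  have : b - a ≠ 0 := by linarith
  field_simp
  ring

lemma scaledIntegrand_le (hp : 2 < p) {a b θ : ℝ} (ha : 0 < a) (hb : 1 < b) (hab : a < b)
    (hf : f p b < f p a) (hθ : θ ∈ Set.Icc (0 : ℝ) 1) :
    scaledIntegrand p a b θ ≤ (b - a) / √(f p a - f p b) * (1 - θ) ^ (-(1 / 2) : ℝ) := by
  rw [div_eq_mul_one_div, mul_assoc]
  refine mul_le_mul_of_nonneg_left (one_div_sqrt_le (by linarith) (by linarith [hθ.2])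
    (mul_one_sub_le_f hp ha hb hab hf hθ) fun h => ?_) (by linarith)
  rw [show θ = 1 by linarith]
  simp

lemma intervalIntegrable_scaledIntegrand (hp : 2 < p) {a b : ℝ} (ha : 0 < a) (hb : 1 < b)
    (hab : a < b) (hf : f p b < f p a) :
    IntervalIntegrable (scaledIntegrand p a b) volume 0 1 := by
  refine ((intervalIntegrable_sub_rpow 0 1 1).const_mul
    ((b - a) / √(f p a - f p b))).mono_fun'
    (measurable_scaledIntegrand hp a b).aestronglyMeasurable ?_
  refine (ae_restrict_iff' measurableSet_uIoc).2 (Filter.Eventually.of_forall fun θ hθ => ?_)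
  rw [Set.uIoc_of_le zero_le_one] at hθ
  beta_reduce
  rw [Real.norm_of_nonneg (scaledIntegrand_nonneg hab.le θ)]
  exact scaledIntegrand_le hp ha hb hab hf (Set.Ioc_subset_Icc_self hθ)

lemma integral_scaledIntegrand_le (hp : 2 < p) {a b : ℝ} (ha : 0 < a) (hb : 1 < b)
    (hab : a < b) (hf : f p b < f p a) :
    ∫ θ in (0 : ℝ)..1, scaledIntegrand p a b θ ≤ 2 * ((b - a) / √(f p a - f p b)) := by
  have h := intervalIntegral.integral_mono_on zero_le_one
    (intervalIntegrable_scaledIntegrand hp ha hb hab hf)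
    ((intervalIntegrable_sub_rpow 0 1 1).const_mul ((b - a) / √(f p a - f p b)))
    (fun θ hθ => scaledIntegrand_le hp ha hb hab hf hθ)
  refine h.trans (le_of_eq ?_)
  rw [intervalIntegral.integral_const_mul,
    intervalIntegral.integral_comp_sub_left (fun t : ℝ => t ^ (-(1 / 2) : ℝ)) 1,
    integral_rpow (Or.inl (by norm_num))]
  norm_num
  ring

/-- Comparison of two scaled integrals from a pointwise comparison of the slopes of `f`. -/
lemma integral_lt_of_scaled_g_lt (hp : 2 < p) {a₁ b₁ a₂ b₂ : ℝ} (ha₁ : 1 ≤ a₁) (h₁ : a₁ < b₁)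
    (ha₂ : 1 ≤ a₂) (h₂ : a₂ < b₂)
    (hg : ∀ η ∈ Set.Ioo (0 : ℝ) 1,
      g p (a₁ + (b₁ - a₁) * η) / (b₁ - a₁) < g p (a₂ + (b₂ - a₂) * η) / (b₂ - a₂)) :
    ∫ t in a₂..b₂, 1 / √(f p t - f p b₂) < ∫ t in a₁..b₁, 1 / √(f p t - f p b₁) := by
  have hd₁ : 0 < b₁ - a₁ := by linarith
  have hd₂ : 0 < b₂ - a₂ := by linarith
  have hf₁ : f p b₁ < f p a₁ := strictAntiOn_f hp ha₁ (ha₁.trans h₁.le) h₁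
  have hf₂ : f p b₂ < f p a₂ := strictAntiOn_f hp ha₂ (ha₂.trans h₂.le) h₂
  have hi₁ := intervalIntegrable_scaledIntegrand hp (by linarith) (by linarith) h₁ hf₁
  have hi₂ := intervalIntegrable_scaledIntegrand hp (by linarith) (by linarith) h₂ hf₂
  rw [integral_eq_scaled, integral_eq_scaled, ← sub_pos, ← intervalIntegral.integral_sub hi₁ hi₂]
  refine intervalIntegral.intervalIntegral_pos_of_pos_on (hi₁.sub hi₂) (fun θ hθ => ?_) one_pos
  have hq : ∀ a b η : ℝ, 0 < b - a → HasDerivAt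
      (fun θ => (f p (a + (b - a) * θ) - f p b) / (b - a) ^ 2)
      (-(g p (a + (b - a) * η) / (b - a))) η := by
    intro a b η hab
    have h := (hasDerivAt_f hp (a + (b - a) * η)).comp η
      (((hasDerivAt_id η).const_mul (b - a)).const_add a)
    refine ((h.sub_const (f p b)).div_const ((b - a) ^ 2)).congr_deriv ?_
    field_simp
  have hanti : StrictAntiOn (fun θ => (f p (a₂ + (b₂ - a₂) * θ) - f p b₂) / (b₂ - a₂) ^ 2 -
      (f p (a₁ + (b₁ - a₁) * θ) - f p b₁) / (b₁ - a₁) ^ 2) (Set.Icc 0 1) := by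
    refine strictAntiOn_of_deriv_neg (convex_Icc 0 1) (fun η _ =>
      ((hq a₂ b₂ η hd₂).sub (hq a₁ b₁ η hd₁)).continuousAt.continuousWithinAt) fun η hη => ?_
    rw [interior_Icc] at hη
    have e := ((hq a₂ b₂ η hd₂).sub (hq a₁ b₁ η hd₁)).deriv
    have := hg η hη
    refine lt_of_eq_of_lt e (by linarith)
  have hlt := hanti (Set.Ioo_subset_Icc_self hθ) (Set.right_mem_Icc.2 zero_le_one) hθ.2
  simp only [mul_one, add_sub_cancel, sub_self, zero_div] at hlt
  have hpos : 0 < f p (a₁ + (b₁ - a₁) * θ) - f p b₁ :=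
    lt_of_lt_of_le (mul_pos (by linarith) (by linarith [hθ.2]))
      (mul_one_sub_le_f hp (by linarith) (by linarith) h₁ hf₁ (Set.Ioo_subset_Icc_self hθ))
  have hs : ∀ a b : ℝ, 0 < b - a →
      scaledIntegrand p a b θ = 1 / √((f p (a + (b - a) * θ) - f p b) / (b - a) ^ 2) := by
    intro a b hab
    rw [Real.sqrt_div' _ (by positivity), Real.sqrt_sq hab.le, one_div_div, scaledIntegrand,
      mul_one_div]
  rw [sub_pos, hs a₁ b₁ hd₁, hs a₂ b₂ hd₂]
  exact one_div_lt_one_div_of_lt (Real.sqrt_pos.2 (div_pos hpos (by positivity)))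
    (Real.sqrt_lt_sqrt (div_nonneg hpos.le (by positivity)) (by linarith))

end Integral

section Endpoint

variable {p : ℝ} {w : ℝ → ℝ}

/-- `w z ∈ [1, ∞)` solves `f (w z) = -3 f z` for every `z` strictly between the zeros of `f`. -/
def IsEndpoint (p : ℝ) (w : ℝ → ℝ) : Prop :=
  ∀ z ∈ Set.Ioo (0 : ℝ) ((p / 2) ^ (1 / (p - 2))), 1 ≤ w z ∧ f p (w z) = -3 * f p z

/-- The length function without its normalisation `1 / √2`. -/
noncomputable def lengthIntegral (p : ℝ) (w : ℝ → ℝ) (z : ℝ) : ℝ :=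
  ∫ t in z..(w z), 1 / √(f p t - f p (w z))

lemma IsEndpoint.f_lt (hp : 2 < p) (hw : IsEndpoint p w) {z : ℝ}
    (hz : z ∈ Set.Ioo (0 : ℝ) ((p / 2) ^ (1 / (p - 2)))) : f p (w z) < f p z := by
  linarith [(hw z hz).2, f_pos hp hz]

lemma IsEndpoint.zero_le (hp : 2 < p) (hw : IsEndpoint p w) {z : ℝ}
    (hz : z ∈ Set.Ioo (0 : ℝ) ((p / 2) ^ (1 / (p - 2)))) : (p / 2) ^ (1 / (p - 2)) ≤ w z := by
  obtain ⟨h1, h2⟩ := hw z hz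
  by_contra! h
  linarith [f_pos hp hz, f_pos hp (z := w z) ⟨by linarith, h⟩]

lemma IsEndpoint.lt (hp : 2 < p) (hw : IsEndpoint p w) {z : ℝ}
    (hz : z ∈ Set.Ioo (0 : ℝ) ((p / 2) ^ (1 / (p - 2)))) : z < w z :=
  hz.2.trans_le (hw.zero_le hp hz)

lemma IsEndpoint.one_lt (hp : 2 < p) (hw : IsEndpoint p w) {z : ℝ}
    (hz : z ∈ Set.Ioo (0 : ℝ) ((p / 2) ^ (1 / (p - 2)))) : 1 < w z :=
  (one_lt_zero_f hp).trans_le (hw.zero_le hp hz)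

lemma IsEndpoint.hasDerivAt (hp : 2 < p) (hw : IsEndpoint p w) {z : ℝ}
    (hz : z ∈ Set.Ioo (0 : ℝ) ((p / 2) ^ (1 / (p - 2)))) :
    HasDerivAt w (-(3 * (g p z / g p (w z)))) z := by
  have h1 := hw.one_lt hp hz
  have hg := g_pos hp h1
  have hs := hasStrictDerivAt_f hp (w z)
  have hne : -g p (w z) ≠ 0 := by linarith
  have hψ := (hs.to_localInverse hne).hasDerivAt
  have hr := hs.eventually_right_inverse hne
  have hself : hs.localInverse _ _ _ hne (f p (w z)) = w z :=
    (hs.hasStrictFDerivAt_equiv hne).localInverse_apply_image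
  have hgt : ∀ᶠ y in nhds (f p (w z)), 1 < hs.localInverse _ _ _ hne y :=
    hψ.continuousAt.eventually (lt_mem_nhds (by rw [hself]; exact h1))
  have hin : HasDerivAt (fun x => -3 * f p x) (-3 * -g p z) z := (hasDerivAt_f hp z).const_mul _
  have heq : f p (w z) = -3 * f p z := (hw z hz).2
  rw [heq] at hr hgt
  rw [heq] at hψ
  have hcomp := HasDerivAt.comp z hψ hin
  have hev : w =ᶠ[nhds z] (hs.localInverse _ _ _ hne) ∘ fun x => -3 * f p x := by
    filter_upwards [hin.continuousAt.eventually hr, hin.continuousAt.eventually hgt,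
      isOpen_Ioo.mem_nhds hz] with x hx1 hx2 hx
    refine (strictAntiOn_f hp).injOn (Set.mem_Ici.2 (hw x hx).1) (Set.mem_Ici.2 hx2.le) ?_
    rw [Function.comp, hx1, (hw x hx).2]
  refine (hcomp.congr_of_eventuallyEq hev).congr_deriv ?_
  field_simp

lemma IsEndpoint.scaled_g_strictMonoOn (hp : 2 < p) (hw : IsEndpoint p w) {η : ℝ}
    (hη : η ∈ Set.Ioo (0 : ℝ) 1) :
    StrictMonoOn (fun z => g p (z + (w z - z) * η) / (w z - z))
      (Set.Ico 1 ((p / 2) ^ (1 / (p - 2)))) := by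
  have hd : ∀ z ∈ Set.Ico 1 ((p / 2) ^ (1 / (p - 2))), HasDerivAt
      (fun z => g p (z + (w z - z) * η) / (w z - z))
      ((((p - 1) * (z + (w z - z) * η) ^ (p - 2) - 1) *
          (1 + (-(3 * (g p z / g p (w z))) - 1) * η) * (w z - z) -
        g p (z + (w z - z) * η) * (-(3 * (g p z / g p (w z))) - 1)) / (w z - z) ^ 2) z := by
    intro z hz
    have hz' : z ∈ Set.Ioo (0 : ℝ) ((p / 2) ^ (1 / (p - 2))) := ⟨by linarith [hz.1], hz.2⟩
    have hD : HasDerivAt (fun z => w z - z) _ z := (hw.hasDerivAt hp hz').sub (hasDerivAt_id z)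
    have ht : HasDerivAt (fun z => z + (w z - z) * η) _ z :=
      (hasDerivAt_id z).add (hD.mul_const η)
    have hgt : HasDerivAt (fun z => g p (z + (w z - z) * η)) _ z :=
      HasDerivAt.comp (h := fun z => z + (w z - z) * η) z (hasDerivAt_g hp _) ht
    exact hgt.div hD (sub_ne_zero.2 (hw.lt hp hz').ne')
  refine strictMonoOn_of_deriv_pos (convex_Ico _ _)
    (fun z hz => (hd z hz).continuousAt.continuousWithinAt) fun z hz => ?_
  rw [interior_Ico] at hz
  rw [(hd z (Set.Ioo_subset_Ico_self hz)).deriv]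
  have hz' : z ∈ Set.Ioo (0 : ℝ) ((p / 2) ^ (1 / (p - 2))) := ⟨by linarith [hz.1], hz.2⟩
  have hzw := hw.lt hp hz'
  have hD : 0 < w z - z := by linarith
  refine div_pos ?_ (by positivity)
  set t := z + (w z - z) * η with ht
  have hzt : z < t := by linarith [mul_pos hD hη.1]
  have htw : t < w z := by nlinarith [hη.2]
  have hgz := g_pos hp hz.1
  have hgt := g_pos hp (hz.1.trans hzt)
  have hgw := g_pos hp (hz.1.trans hzw)
  have hg' := deriv_g_pos hp (hz.1.trans hzt)
  have hlog := sub_mul_deriv_g_le hp hz.1 hzt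
  have hgtw : Real.log (g p t) ≤ Real.log (g p (w z)) :=
    Real.log_le_log hgt (strictMonoOn_g hp (hz.1.trans hzt).le (hz.1.trans hzw).le htw).le
  set r := g p z / g p (w z) with hr
  have hr0 : 0 < r := div_pos hgz hgw
  have hr1 : r < 1 := (div_lt_one hgw).2 (strictMonoOn_g hp hz.1.le (hz.1.trans hzw).le hzw)
  have hrl := three_mul_mul_log_inv_lt hr0 hr1
  have hlr : Real.log r⁻¹ = Real.log (g p (w z)) - Real.log (g p z) := by
    rw [hr, inv_div, Real.log_div hgw.ne' hgz.ne']
  set G := (p - 1) * t ^ (p - 2) - 1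
  have h1 : (w z - z) * η * G ≤ g p t * Real.log r⁻¹ := by
    rw [hlr]
    refine le_trans (le_of_eq ?_) (hlog.trans (mul_le_mul_of_nonneg_left (by linarith) hgt.le))
    rw [ht]
    ring
  have h2 : 3 * r * ((w z - z) * η * G) < g p t * (1 + 3 * r) :=
    calc 3 * r * ((w z - z) * η * G) ≤ 3 * r * (g p t * Real.log r⁻¹) :=
          mul_le_mul_of_nonneg_left h1 (by linarith)
      _ = g p t * (3 * r * Real.log r⁻¹) := by ring
      _ < g p t * (1 + 3 * r) := mul_lt_mul_of_pos_left hrl hgt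
  have h3 : 0 < G * (w z - z) * (1 - η) := mul_pos (mul_pos hg' hD) (by linarith [hη.2])
  linarith

lemma IsEndpoint.lengthIntegral_strictAntiOn_Ico (hp : 2 < p) (hw : IsEndpoint p w) :
    StrictAntiOn (lengthIntegral p w) (Set.Ico 1 ((p / 2) ^ (1 / (p - 2)))) := by
  intro x hx y hy hxy
  exact integral_lt_of_scaled_g_lt hp hx.1 (hw.lt hp ⟨by linarith [hx.1], hx.2⟩) hy.1
    (hw.lt hp ⟨by linarith [hy.1], hy.2⟩) fun η hη => hw.scaled_g_strictMonoOn hp hη hx hy hxy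

lemma integral_one_lt (hp : 2 < p) {a b : ℝ} (ha : 1 < a) (hab : a < b) :
    ∫ t in (1 : ℝ)..b, 1 / √(f p t - f p b) < ∫ t in (1 : ℝ)..a, 1 / √(f p t - f p a) := by
  refine integral_lt_of_scaled_g_lt hp le_rfl ha le_rfl (ha.trans hab) fun η hη => ?_
  have h0 : 0 < a - 1 := by linarith
  have h1 : 0 < b - 1 := by linarith
  have hq : (a - 1) / (b - 1) < 1 := (div_lt_one h1).2 (by linarith)
  have hc := (strictConvexOn_g hp).2 (Set.mem_Ici.2 zero_le_one)
    (Set.mem_Ici.2 (by nlinarith [hη.1] : 0 ≤ 1 + (b - 1) * η))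
    (by nlinarith [mul_pos h1 hη.1]) (by linarith : 0 < 1 - (a - 1) / (b - 1)) (div_pos h0 h1)
    (by ring)
  have e : (1 - (a - 1) / (b - 1)) • (1 : ℝ) + ((a - 1) / (b - 1)) • (1 + (b - 1) * η) =
      1 + (a - 1) * η := by
    simp only [smul_eq_mul]
    field_simp
    ring
  rw [e, g_one, smul_zero, zero_add, smul_eq_mul] at hc
  rw [div_lt_iff₀ h0]
  refine hc.trans_eq ?_
  ring

lemma IsEndpoint.lengthIntegral_strictAntiOn_Ioc (hp : 2 < p) (hw : IsEndpoint p w) :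
    StrictAntiOn (lengthIntegral p w) (Set.Ioc 0 1) := by
  intro x hx y hy hxy
  have hZ := one_lt_zero_f hp
  have hx' : x ∈ Set.Ioo (0 : ℝ) ((p / 2) ^ (1 / (p - 2))) := ⟨hx.1, hx.2.trans_lt hZ⟩
  have hy' : y ∈ Set.Ioo (0 : ℝ) ((p / 2) ^ (1 / (p - 2))) := ⟨hy.1, hy.2.trans_lt hZ⟩
  have hfxy : f p x < f p y :=
    strictMonoOn_f hp (Set.Ioc_subset_Icc_self hx) (Set.Ioc_subset_Icc_self hy) hxy
  have hfw : f p (w y) < f p (w x) := by linarith [(hw x hx').2, (hw y hy').2]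
  have hwxy : w x < w y := ((strictAntiOn_f hp).lt_iff_gt (hw y hy').1 (hw x hx').1).1 hfw
  have key : ∀ z ∈ Set.Ioo (0 : ℝ) ((p / 2) ^ (1 / (p - 2))), ∀ c ∈ Set.Icc z (w z),
      IntervalIntegrable (fun t => 1 / √(f p t - f p (w z))) volume z c ∧
      IntervalIntegrable (fun t => 1 / √(f p t - f p (w z))) volume c (w z) := by
    intro z hz c hc
    have := intervalIntegrable_one_div_sqrt hp hz.1 (hw.one_lt hp hz) (hw.lt hp hz)
      (hw.f_lt hp hz)
    have hcu : c ∈ Set.uIcc z (w z) := by rwa [Set.uIcc_of_le (hw.lt hp hz).le]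
    exact ⟨this.mono_set (Set.uIcc_subset_uIcc_left hcu),
      this.mono_set (Set.uIcc_subset_uIcc_right hcu)⟩
  have h1x : (1 : ℝ) ∈ Set.Icc x (w x) := ⟨hx.2, (hw x hx').1⟩
  have h1y : (1 : ℝ) ∈ Set.Icc y (w y) := ⟨hy.2, (hw y hy').1⟩
  have hyx : y ∈ Set.Icc x (w x) := ⟨hxy.le, hy.2.trans h1x.2⟩
  have hyx1 : IntervalIntegrable (fun t => 1 / √(f p t - f p (w x))) volume y 1 :=
    (key x hx' y hyx).1.symm.trans (key x hx' 1 h1x).1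
  have hsplit_y := intervalIntegral.integral_add_adjacent_intervals (key y hy' 1 h1y).1
    (key y hy' 1 h1y).2
  have hsplit_x := intervalIntegral.integral_add_adjacent_intervals (key x hx' 1 h1x).1
    (key x hx' 1 h1x).2
  have hsplit_x1 := intervalIntegral.integral_add_adjacent_intervals (key x hx' y hyx).1 hyx1
  have hpos : ∀ t ∈ Set.Icc x 1, 0 < f p t - f p (w x) := by
    intro t ht
    have : f p x ≤ f p t := (strictMonoOn_f hp).monotoneOn (Set.Ioc_subset_Icc_self hx)
      ⟨hx.1.le.trans ht.1, ht.2⟩ ht.1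
    linarith [hw.f_lt hp hx']
  have h1 : 0 < ∫ t in x..y, 1 / √(f p t - f p (w x)) :=
    intervalIntegral.intervalIntegral_pos_of_pos_on (key x hx' y hyx).1
      (fun t ht => one_div_pos.2 (Real.sqrt_pos.2 (hpos t ⟨ht.1.le, ht.2.le.trans hy.2⟩))) hxy
  have h2 : ∫ t in y..1, 1 / √(f p t - f p (w y)) ≤ ∫ t in y..1, 1 / √(f p t - f p (w x)) := by
    refine intervalIntegral.integral_mono_on hy.2 (key y hy' 1 h1y).1 hyx1 fun t ht => ?_
    exact one_div_le_one_div_of_le (Real.sqrt_pos.2 (hpos t ⟨hxy.le.trans ht.1, ht.2⟩))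
      (Real.sqrt_le_sqrt (by linarith))
  have h3 := integral_one_lt hp (hw.one_lt hp hx') hwxy
  unfold lengthIntegral
  linarith

lemma IsEndpoint.lengthIntegral_strictAntiOn (hp : 2 < p) (hw : IsEndpoint p w) :
    StrictAntiOn (lengthIntegral p w) (Set.Ioo 0 ((p / 2) ^ (1 / (p - 2)))) := by
  have hZ := one_lt_zero_f hp
  have := (hw.lengthIntegral_strictAntiOn_Ioc hp).union (hw.lengthIntegral_strictAntiOn_Ico hp)
    (isGreatest_Ioc zero_lt_one) (isLeast_Ico hZ)
  rwa [Set.Ioc_union_Ico_eq_Ioo zero_lt_one hZ] at this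

lemma IsEndpoint.continuousOn_lengthIntegral (hp : 2 < p) (hw : IsEndpoint p w) :
    ContinuousOn (lengthIntegral p w) (Set.Ioo 0 ((p / 2) ^ (1 / (p - 2)))) := by
  intro z hz
  refine ContinuousAt.continuousWithinAt ?_
  have hwc := (hw.hasDerivAt hp hz).continuousAt
  have hfc : ∀ x, ContinuousAt (f p) x := fun x => (continuous_f hp).continuousAt
  have hfwc : ContinuousAt (fun x => f p (w x)) z := (hfc _).comp hwc
  have hCc : ContinuousAt (fun x => (w x - x) / √(f p x - f p (w x))) z :=
    (hwc.sub continuousAt_id).div ((hfc z).sub hfwc).sqrt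
      (Real.sqrt_pos.2 (by linarith [hw.f_lt hp hz])).ne'
  have hfun : lengthIntegral p w =
      fun x => ∫ θ in (0 : ℝ)..1, scaledIntegrand p x (w x) θ :=
    funext fun x => integral_eq_scaled p x (w x)
  rw [hfun]
  refine intervalIntegral.continuousAt_of_dominated_interval
    (bound := fun θ => ((w z - z) / √(f p z - f p (w z)) + 1) * (1 - θ) ^ (-(1 / 2) : ℝ))
    (Filter.Eventually.of_forall fun x =>
      (measurable_scaledIntegrand hp x (w x)).aestronglyMeasurable) ?_
    ((intervalIntegrable_sub_rpow 0 1 1).const_mul _) ?_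
  · filter_upwards [isOpen_Ioo.mem_nhds hz,
      hCc.eventually (gt_mem_nhds (lt_add_one _))] with x hx hxC
    refine Filter.Eventually.of_forall fun θ hθ => ?_
    rw [Set.uIoc_of_le zero_le_one] at hθ
    rw [Real.norm_of_nonneg (scaledIntegrand_nonneg (hw.lt hp hx).le θ)]
    refine (scaledIntegrand_le hp hx.1 (hw.one_lt hp hx) (hw.lt hp hx) (hw.f_lt hp hx)
      (Set.Ioc_subset_Icc_self hθ)).trans ?_
    exact mul_le_mul_of_nonneg_right hxC.le (Real.rpow_nonneg (by linarith [hθ.2]) _)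
  · filter_upwards [Measure.ae_ne volume (1 : ℝ)] with θ hθ1 hθ
    rw [Set.uIoc_of_le zero_le_one] at hθ
    have hlt : θ < 1 := lt_of_le_of_ne hθ.2 hθ1
    have hpos : 0 < f p (z + (w z - z) * θ) - f p (w z) :=
      lt_of_lt_of_le (mul_pos (by linarith [hw.f_lt hp hz]) (by linarith))
        (mul_one_sub_le_f hp hz.1 (hw.one_lt hp hz) (hw.lt hp hz) (hw.f_lt hp hz)
          (Set.Ioc_subset_Icc_self hθ))
    have harg : ContinuousAt (fun x => x + (w x - x) * θ) z :=
      continuousAt_id.add ((hwc.sub continuousAt_id).mul_const θ)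
    have hft : ContinuousAt (fun x => f p (x + (w x - x) * θ)) z :=
      ContinuousAt.comp (f := fun x => x + (w x - x) * θ) (hfc _) harg
    exact (hwc.sub continuousAt_id).mul
      (continuousAt_const.div (hft.sub hfwc).sqrt (Real.sqrt_pos.2 hpos).ne')

lemma IsEndpoint.exists_lengthIntegral_lt (hp : 2 < p) (hw : IsEndpoint p w) {ε : ℝ}
    (hε : 0 < ε) :
    ∃ z ∈ Set.Ioo (0 : ℝ) ((p / 2) ^ (1 / (p - 2))), lengthIntegral p w z < ε := by
  have hZ := one_lt_zero_f hp
  obtain ⟨m, hm1, hmZ⟩ := exists_between hZ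
  have hc := g_pos hp hm1
  have hlim : ContinuousAt (fun z => 2 * (√(4 * f p z) / g p m)) ((p / 2) ^ (1 / (p - 2))) :=
    (((continuous_f hp).continuousAt.const_mul 4).sqrt.div_const _).const_mul 2
  have hev : ∀ᶠ z in nhds ((p / 2) ^ (1 / (p - 2))), 2 * (√(4 * f p z) / g p m) < ε :=
    hlim.eventually (gt_mem_nhds (by beta_reduce; rw [f_zero_eq hp]; simpa using hε))
  obtain ⟨z, hzε, hmz, hzZ⟩ := ((hev.filter_mono nhdsWithin_le_nhds).and
    (Ioo_mem_nhdsLT hmZ)).exists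
  have hz : z ∈ Set.Ioo (0 : ℝ) ((p / 2) ^ (1 / (p - 2))) := ⟨by linarith, hzZ⟩
  refine ⟨z, hz, lt_of_le_of_lt ?_ hzε⟩
  have hzw := hw.lt hp hz
  have hf : f p z - f p (w z) = 4 * f p z := by linarith [(hw z hz).2]
  rw [lengthIntegral, integral_eq_scaled]
  refine (integral_scaledIntegrand_le hp hz.1 (hw.one_lt hp hz) hzw (hw.f_lt hp hz)).trans ?_
  rw [hf]
  refine mul_le_mul_of_nonneg_left ?_ two_pos.le
  have h4 : 0 < 4 * f p z := by linarith [f_pos hp hz]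
  rw [div_le_div_iff₀ (Real.sqrt_pos.2 h4) hc, Real.mul_self_sqrt h4.le, ← hf]
  obtain ⟨c, hcI, hceq⟩ := exists_hasDerivAt_eq_slope (f p) (fun t => -g p t) hzw
    (continuous_f hp).continuousOn fun t _ => hasDerivAt_f hp t
  have hgc : g p m ≤ g p c := (strictMonoOn_g hp).monotoneOn (Set.mem_Ici.2 hm1.le)
    (Set.mem_Ici.2 (by linarith [hcI.1])) (by linarith [hcI.1])
  have hD : 0 < w z - z := by linarith
  rw [eq_div_iff hD.ne'] at hceq
  nlinarith

lemma IsEndpoint.log_le_lengthIntegral (hp : 2 < p) (hw : IsEndpoint p w) {z : ℝ} (h0 : 0 < z)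
    (h1 : z < 1) : 1 / √2 * Real.log (1 / z) ≤ lengthIntegral p w z := by
  have hz : z ∈ Set.Ioo (0 : ℝ) ((p / 2) ^ (1 / (p - 2))) := ⟨h0, h1.trans (one_lt_zero_f hp)⟩
  have h1w := hw.one_lt hp hz
  have hzw := hw.lt hp hz
  have hi := intervalIntegrable_one_div_sqrt hp h0 h1w hzw (hw.f_lt hp hz)
  have h1u : (1 : ℝ) ∈ Set.uIcc z (w z) := by
    rw [Set.uIcc_of_le hzw.le]
    exact ⟨h1.le, h1w.le⟩
  have hi1 := hi.mono_set (Set.uIcc_subset_uIcc_left h1u)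
  have hi2 := hi.mono_set (Set.uIcc_subset_uIcc_right h1u)
  have h0u : (0 : ℝ) ∉ Set.uIcc z 1 := by
    rw [Set.uIcc_of_le h1.le]
    exact fun h => absurd h.1 (by linarith)
  have hfle : ∀ t, 0 < t → f p t ≤ t ^ 2 / 2 := fun t ht =>
    sub_le_self _ (div_nonneg (Real.rpow_nonneg ht.le p) (by linarith))
  rw [lengthIntegral, ← intervalIntegral.integral_add_adjacent_intervals hi1 hi2,
    ← integral_one_div h0u, ← intervalIntegral.integral_const_mul]
  refine le_add_of_le_of_nonneg (intervalIntegral.integral_mono_on h1.le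
    ((intervalIntegral.intervalIntegrable_one_div (fun t ht h => h0u (h ▸ ht))
      continuousOn_id).const_mul _) hi1 fun t ht => ?_)
    (intervalIntegral.integral_nonneg h1w.le fun t _ => by positivity)
  have ht0 : 0 < t := h0.trans_le ht.1
  have hft : f p z ≤ f p t := (strictMonoOn_f hp).monotoneOn ⟨h0.le, h1.le⟩ ⟨ht0.le, ht.2⟩ ht.1
  rw [one_div_mul_one_div]
  refine one_div_le_one_div_of_le (Real.sqrt_pos.2 (by linarith [hw.f_lt hp hz])) ?_
  rw [← Real.sqrt_sq ht0.le, ← Real.sqrt_mul zero_le_two, Real.sqrt_sq ht0.le]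
  refine Real.sqrt_le_sqrt ?_
  nlinarith [hfle t ht0, hfle z h0, (hw z hz).2, ht.1]

end Endpoint

/-- for every `p > 2` and every `ℓ > 0` there exists a unique
`z ∈ (0, (p/2)^(1/(p-2)))` with `L(z) = ℓ`, where `L` is the length function
`L(z) = (1/√2) ∫_z^{w(z)} dt/√(f(t)+3f(z))` and `w(z) ∈ [1,∞)` is the unique point with
`f(w(z)) = -3 f(z)`. -/
theorem stmt_7 (p : ℝ) (hp : 2 < p) (w : ℝ → ℝ)
    (hw : ∀ z ∈ Set.Ioc (0 : ℝ) ((p / 2) ^ (1 / (p - 2))),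
      1 ≤ w z ∧ f p (w z) = -3 * f p z)
    (L : ℝ → ℝ)
    (hL : ∀ z ∈ Set.Ioc (0 : ℝ) ((p / 2) ^ (1 / (p - 2))),
      L z = (1 / Real.sqrt 2) * ∫ t in z..(w z), 1 / Real.sqrt (f p t + 3 * f p z))
    (ℓ : ℝ) (hℓ : 0 < ℓ) :
    ∃! z : ℝ, z ∈ Set.Ioo (0 : ℝ) ((p / 2) ^ (1 / (p - 2))) ∧ L z = ℓ := by
  have hw' : IsEndpoint p w := fun z hz => hw z (Set.Ioo_subset_Ioc_self hz)
  have hs : 0 < √2 := Real.sqrt_pos.2 two_pos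
  have hL' : ∀ z ∈ Set.Ioo (0 : ℝ) ((p / 2) ^ (1 / (p - 2))),
      L z = ℓ ↔ lengthIntegral p w z = √2 * ℓ := by
    intro z hz
    have : ∀ t, f p t + 3 * f p z = f p t - f p (w z) := fun t => by linarith [(hw' z hz).2]
    rw [hL z (Set.Ioo_subset_Ioc_self hz)]
    simp only [this]
    rw [← lengthIntegral, one_div, inv_mul_eq_iff_eq_mul₀ hs.ne']
  obtain ⟨b, hb, hbℓ⟩ := hw'.exists_lengthIntegral_lt hp (mul_pos hs hℓ)
  have hexp : Real.exp (-(2 * ℓ)) < 1 := Real.exp_lt_one_iff.2 (by linarith)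
  have hℓa := hw'.log_le_lengthIntegral hp (Real.exp_pos _) hexp
  rw [one_div (Real.exp _), ← Real.exp_neg, neg_neg, Real.log_exp] at hℓa
  have e : 1 / √2 * (2 * ℓ) = √2 * ℓ := by
    rw [← mul_assoc, one_div_mul_eq_div, Real.div_sqrt]
  rw [e] at hℓa
  obtain ⟨z, hz, hzℓ⟩ := isPreconnected_Ioo.intermediate_value hb
    ⟨Real.exp_pos _, hexp.trans (one_lt_zero_f hp)⟩ (hw'.continuousOn_lengthIntegral hp)
    ⟨hbℓ.le, hℓa⟩
  refine ⟨z, ⟨hz, (hL' z hz).2 hzℓ⟩, fun y ⟨hy, hyℓ⟩ => ?_⟩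
  exact (hw'.lengthIntegral_strictAntiOn hp).injOn hy hz (((hL' y hy).1 hyℓ).trans hzℓ.symm)
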